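/- arXiv:math/0312323 — 2 statements merged into one kernel-verified Lean document; each statement's English description precedes it below -/
import Mathlib

section
/- Let P ∈ ℂ[t], D the derivation Df = P·(df/dt), A an n×n polynomial matrix, and 𝒫(t) an n×n matrix of functions analytic on a domain U with P·𝒫′ = A·𝒫. Let q_0 ∈ ℂⁿ be a constant row vector, q_{k+1} = Dq_k + q_k·A, let Σ be the polynomial matrix with rows q_0, …, q_{n−1}, and set y_j = (q_0·𝒫)_j for j = 1, …, n. Then det Σ · det 𝒫 = W_D(y_1, …, y_n) = P^{n(n−1)/2} · W(y_1, …, y_n) on U, where W_D is the Wronskian determinant computed with the derivation D and W is the usual Wronskian determinant. -/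
open scoped BigOperators

/-- The derivation `D f = P · f'` associated to a polynomial `P`. -/
noncomputable def DopP (P : Polynomial ℂ) (f : ℂ → ℂ) : ℂ → ℂ := fun t => P.eval t * deriv f t

/-- The usual Wronskian determinant `W(y₁, …, y_n)(t) = det(y_j^{(k)}(t))`. -/
noncomputable def wronskian {n : ℕ} (y : Fin n → ℂ → ℂ) : ℂ → ℂ :=
  fun t => (Matrix.of fun k j : Fin n => iteratedDeriv (k : ℕ) (y j) t).det

/-- The Wronskian determinant computed with the derivation `D f = P·f'`. -/
noncomputable def wronskianD (P : Polynomial ℂ) {n : ℕ} (y : Fin n → ℂ → ℂ) : ℂ → ℂ :=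
  fun t => (Matrix.of fun k j : Fin n => (DopP P)^[(k : ℕ)] (y j) t).det

/-- Coefficients of the expansion `D^k f = ∑ m, c_{k,m} · f^{(m)}` of the iterates of
`D f = P · f'`. -/
noncomputable def derivationCoeff (P : Polynomial ℂ) : ℕ → ℕ → Polynomial ℂ
  | 0, 0 => 1
  | 0, _ + 1 => 0
  | k + 1, 0 => P * Polynomial.derivative (derivationCoeff P k 0)
  | k + 1, m + 1 =>
    P * Polynomial.derivative (derivationCoeff P k (m + 1)) + P * derivationCoeff P k m

theorem derivationCoeff_eq_zero_of_lt (P : Polynomial ℂ) {k m : ℕ} (h : k < m) :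
    derivationCoeff P k m = 0 := by
  induction k generalizing m with
  | zero => cases m with
    | zero => omega
    | succ m => rfl
  | succ k ih => cases m with
    | zero => omega
    | succ m => simp [derivationCoeff, ih (show k < m by omega), ih (show k < m + 1 by omega)]

theorem derivationCoeff_self (P : Polynomial ℂ) (k : ℕ) : derivationCoeff P k k = P ^ k := by
  induction k with
  | zero => rfl
  | succ k ih =>
    simp [derivationCoeff, derivationCoeff_eq_zero_of_lt P (Nat.lt_succ_self k), ih, pow_succ']

/-- `D (∑ i, p_i · g_i)` for polynomials `p_i` and functions `g_i` differentiable at `t`. -/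
theorem DopP_sum_eval_mul {ι : Type*} (s : Finset ι) (P : Polynomial ℂ) (p : ι → Polynomial ℂ)
    (g : ι → ℂ → ℂ) {t : ℂ} (hg : ∀ i ∈ s, DifferentiableAt ℂ (g i) t) :
    DopP P (fun z => ∑ i ∈ s, (p i).eval z * g i z) t =
      ∑ i ∈ s, (P.eval t * (Polynomial.derivative (p i)).eval t * g i t
        + (p i).eval t * (P.eval t * deriv (g i) t)) := by
  have h : HasDerivAt (fun z => ∑ i ∈ s, (p i).eval z * g i z)
      (∑ i ∈ s, ((Polynomial.derivative (p i)).eval t * g i t + (p i).eval t * deriv (g i) t)) t :=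
    HasDerivAt.fun_sum fun i hi => ((p i).hasDerivAt t).mul (hg i hi).hasDerivAt
  rw [DopP, h.deriv, Finset.mul_sum]
  exact Finset.sum_congr rfl fun i _ => by ring

theorem DopP_congr {U : Set ℂ} (hU : IsOpen U) (P : Polynomial ℂ) {f g : ℂ → ℂ}
    (h : Set.EqOn f g U) : Set.EqOn (DopP P f) (DopP P g) U := fun t ht => by
  rw [DopP, DopP, (h.eventuallyEq_of_mem (hU.mem_nhds ht)).deriv_eq]

theorem iterate_DopP_eq_sum_iteratedDeriv {U : Set ℂ} (hU : IsOpen U) (P : Polynomial ℂ)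
    {f : ℂ → ℂ} (hf : AnalyticOnNhd ℂ f U) {n k : ℕ} (hk : k < n) :
    Set.EqOn ((DopP P)^[k] f)
      (fun t => ∑ m ∈ Finset.range n, (derivationCoeff P k m).eval t * iteratedDeriv m f t) U := by
  obtain ⟨n, rfl⟩ : ∃ n', n = n' + 1 := ⟨n - 1, by omega⟩
  induction k with
  | zero =>
    intro t _
    simp [Finset.sum_range_succ', derivationCoeff]
  | succ k ih =>
    intro t ht
    have hd : ∀ m ∈ Finset.range (n + 1), DifferentiableAt ℂ (iteratedDeriv m f) t := fun m _ => by
      rw [iteratedDeriv_eq_iterate]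
      exact (hf.iterated_deriv m t ht).differentiableAt
    rw [Function.iterate_succ_apply', DopP_congr hU P (ih (by omega)) ht,
      DopP_sum_eval_mul _ _ _ _ hd, Finset.sum_add_distrib, Finset.sum_range_succ',
      Finset.sum_range_succ (fun m => _ * (_ * _))]
    simp only [derivationCoeff_eq_zero_of_lt P (show k < n by omega), ← iteratedDeriv_succ,
      Finset.sum_range_succ' _ n, derivationCoeff, Polynomial.eval_add, Polynomial.eval_mul,
      Polynomial.eval_zero, add_mul, Finset.sum_add_distrib, zero_mul, add_zero]
    simp only [mul_left_comm, mul_assoc]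
    ring

theorem wronskianD_eq_pow_mul_wronskian {U : Set ℂ} (hU : IsOpen U) (P : Polynomial ℂ) {n : ℕ}
    {y : Fin n → ℂ → ℂ} (hy : ∀ j, AnalyticOnNhd ℂ (y j) U) {t : ℂ} (ht : t ∈ U) :
    wronskianD P y t = P.eval t ^ (n * (n - 1) / 2) * wronskian y t := by
  set L : Matrix (Fin n) (Fin n) ℂ := Matrix.of fun k m => (derivationCoeff P k m).eval t
  have hL : L.det = P.eval t ^ (n * (n - 1) / 2) := by
    rw [Matrix.det_of_isLowerTriangular L fun i j hij => by
      simp [L, derivationCoeff_eq_zero_of_lt P (show (i : ℕ) < j from hij)]]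
    simp only [L, Matrix.of_apply, derivationCoeff_self, Polynomial.eval_pow]
    rw [Finset.prod_pow_eq_pow_sum, Fin.sum_univ_eq_sum_range (fun i => i), Finset.sum_range_id]
  rw [wronskianD, wronskian, ← hL, ← Matrix.det_mul]
  congr 1
  ext k j
  simp only [L, Matrix.mul_apply, Matrix.of_apply]
  rw [iterate_DopP_eq_sum_iteratedDeriv hU P (hy j) k.isLt ht]
  exact (Fin.sum_univ_eq_sum_range
    (fun m => (derivationCoeff P k m).eval t * iteratedDeriv m (y j) t) n).symm

/-- If `D F = A F` on `U` and `q_{k+1} = D q_k + q_k A`, then `D^k (q_0 F) = q_k F` on `U`. -/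
theorem iterate_DopP_row_mul {ι κ : Type*} [Fintype ι] {U : Set ℂ} (hU : IsOpen U)
    (P : Polynomial ℂ) (A : Matrix ι ι (Polynomial ℂ)) (F : ℂ → Matrix ι κ ℂ)
    (hF : ∀ i j, AnalyticOnNhd ℂ (fun t => F t i j) U)
    (hFd : ∀ t ∈ U, ∀ i j,
      P.eval t * deriv (fun s => F s i j) t = ∑ m, (A i m).eval t * F t m j)
    (q : ℕ → ι → Polynomial ℂ)
    (hq : ∀ k j, q (k + 1) j = P * Polynomial.derivative (q k j) + ∑ m, q k m * A m j)
    (k : ℕ) (j : κ) :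
    Set.EqOn ((DopP P)^[k] fun t => ∑ i, (q 0 i).eval t * F t i j)
      (fun t => ∑ i, (q k i).eval t * F t i j) U := by
  induction k with
  | zero => exact fun t _ => rfl
  | succ k ih =>
    intro t ht
    rw [Function.iterate_succ_apply', DopP_congr hU P ih ht,
      DopP_sum_eval_mul _ _ _ (fun i z => F z i j) fun i _ => (hF i j t ht).differentiableAt]
    simp only [hFd t ht, hq, Polynomial.eval_add, Polynomial.eval_mul, Polynomial.eval_finsetSum,
      add_mul, Finset.sum_add_distrib, Finset.mul_sum, Finset.sum_mul, mul_assoc]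
    rw [Finset.sum_comm (f := fun i m => (q k i).eval t * _)]

/-- with `P·Pmat′ = A·Pmat` on a domain `U`, `q₀` constant, `q_{k+1} = Dq_k + q_k·A`,
`Σ` the matrix with rows `q_0, …, q_{n−1}` and `y_j = (q₀·Pmat)_j`, one has
`det Σ · det Pmat = W_D(y₁, …, y_n) = P^{n(n−1)/2} · W(y₁, …, y_n)` on `U`. -/
theorem det_rows_mul_det_fundamental_eq_wronskian
    (n : ℕ) (U : Set ℂ) (hU : IsOpen U) (hUconn : IsConnected U)
    (P : Polynomial ℂ) (A : Matrix (Fin n) (Fin n) (Polynomial ℂ))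
    (Pmat : ℂ → Matrix (Fin n) (Fin n) ℂ)
    (hPa : ∀ i j, AnalyticOnNhd ℂ (fun t => Pmat t i j) U)
    (hPd : ∀ t ∈ U, ∀ i j,
      P.eval t * deriv (fun s => Pmat s i j) t = ∑ m, (A i m).eval t * Pmat t m j)
    (q₀ : Fin n → ℂ) (q : ℕ → Fin n → Polynomial ℂ)
    (hq0 : ∀ j, q 0 j = Polynomial.C (q₀ j))
    (hqs : ∀ k j, q (k + 1) j = P * Polynomial.derivative (q k j) + ∑ m, q k m * A m j)
    (y : Fin n → ℂ → ℂ) (hy : ∀ j, y j = fun t => ∑ i, q₀ i * Pmat t i j) :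
    ∀ t ∈ U,
      (Matrix.of fun k i : Fin n => (q (k : ℕ) i).eval t).det * (Pmat t).det
        = wronskianD P y t ∧
      wronskianD P y t = P.eval t ^ (n * (n - 1) / 2) * wronskian y t := by
  intro t ht
  have hy' : ∀ j, y j = fun t => ∑ i, (q 0 i).eval t * Pmat t i j := fun j => by
    simp [hy, hq0]
  refine ⟨?_, wronskianD_eq_pow_mul_wronskian hU P (fun j => ?_) ht⟩
  · rw [wronskianD, ← Matrix.det_mul]
    congr 1
    ext k j
    simp only [Matrix.mul_apply, Matrix.of_apply]
    rw [hy', iterate_DopP_row_mul hU P A Pmat hPa hPd q hqs k j ht]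
  · rw [hy]
    exact Finset.analyticOnNhd_fun_sum _ fun i _ => analyticOnNhd_const.mul (hPa i j)
end

section
/- Let P ∈ ℂ[t], D the derivation Df = P·(df/dt), A an n×n polynomial matrix, and 𝒫(t) an n×n matrix of functions analytic in a neighbourhood of t_0 ∈ ℂ with P·𝒫′ = A·𝒫. Let q_0 ∈ ℂⁿ, q_{k+1} = Dq_k + q_k·A, Σ the polynomial matrix with rows q_0, …, q_{n−1}, and y_j = (q_0·𝒫)_j. Assume t_0 is non-singular for the system: P(t_0) ≠ 0 and det 𝒫(t_0) ≠ 0. Then the usual Wronskian W(y_1, …, y_n) is identically zero near t_0 if and only if the polynomial det Σ is the zero polynomial, and if they are nonzero, the order of vanishing at t_0 of the analytic function W(y_1, …, y_n) equals the order of vanishing at t_0 of the polynomial det Σ. -/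
open scoped BigOperators

/-- The order of vanishing at `t₀` of a function analytic near `t₀`. -/
noncomputable def ordAt (f : ℂ → ℂ) (t₀ : ℂ) : ℕ := sInf {k | iteratedDeriv k f t₀ ≠ 0}

open Filter Topology

theorem ordAt_eq_of_analyticOrderAt_eq {f : ℂ → ℂ} {t₀ : ℂ} {m : ℕ} (hf : AnalyticAt ℂ f t₀)
    (h : analyticOrderAt f t₀ = m) : ordAt f t₀ = m := by
  obtain ⟨hlt, hm⟩ := (analyticOrderAt_eq_nat_iff_iteratedDeriv_eq_zero hf).1 h
  refine le_antisymm (Nat.sInf_le hm) ?_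
  by_contra! hc
  exact Nat.sInf_mem (s := {k | iteratedDeriv k f t₀ ≠ 0}) ⟨m, hm⟩ (hlt _ hc)

theorem Polynomial.analyticAt_eval (p : Polynomial ℂ) (t : ℂ) :
    AnalyticAt ℂ (fun s => p.eval s) t := by
  simpa using (analyticAt_id (𝕜 := ℂ) (z := t)).aeval_polynomial p

theorem Polynomial.analyticOrderAt_eval {p : Polynomial ℂ} (hp : p ≠ 0) (t₀ : ℂ) :
    analyticOrderAt (fun t => p.eval t) t₀ = p.rootMultiplicity t₀ := by
  obtain ⟨g, hg, hndvd⟩ := p.exists_eq_pow_rootMultiplicity_mul_and_not_dvd hp t₀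
  refine ((p.analyticAt_eval t₀).analyticOrderAt_eq_natCast).2
    ⟨fun t => g.eval t, g.analyticAt_eval t₀, ?_, .of_forall fun t => ?_⟩
  · simpa [Polynomial.dvd_iff_isRoot] using hndvd
  · conv_lhs => rw [hg]
    simp

theorem AnalyticAt.iteratedDeriv_complex {f : ℂ → ℂ} {t : ℂ} (hf : AnalyticAt ℂ f t) (k : ℕ) :
    AnalyticAt ℂ (iteratedDeriv k f) t := by
  rw [iteratedDeriv_eq_iterate]
  exact hf.iterated_deriv k

theorem AnalyticAt.matrix_det {n : ℕ} {M : ℂ → Matrix (Fin n) (Fin n) ℂ} {t : ℂ}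
    (hM : ∀ i j, AnalyticAt ℂ (fun s => M s i j) t) : AnalyticAt ℂ (fun s => (M s).det) t := by
  simp only [Matrix.det_apply']
  exact Finset.analyticAt_fun_sum _ fun σ _ =>
    analyticAt_const.fun_mul (Finset.analyticAt_fun_prod _ fun i _ => hM (σ i) i)

theorem analyticAt_wronskian {n : ℕ} {y : Fin n → ℂ → ℂ} {t : ℂ}
    (hy : ∀ j, AnalyticAt ℂ (y j) t) : AnalyticAt ℂ (wronskian y) t :=
  AnalyticAt.matrix_det (M := fun s => Matrix.of fun k j : Fin n => iteratedDeriv (k : ℕ) (y j) s)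
    fun k j => (hy j).iteratedDeriv_complex k

theorem DopP_congr_s9 (P : Polynomial ℂ) {f g : ℂ → ℂ} {t₀ : ℂ} (h : f =ᶠ[𝓝 t₀] g) :
    DopP P f =ᶠ[𝓝 t₀] DopP P g := by
  filter_upwards [h.deriv] with t ht
  simp [DopP, ht]

/-- The coefficient of the `m`-th derivative in the expansion of `(P · d/dt)^k`. -/
noncomputable def iterateDopCoeff (P : Polynomial ℂ) : ℕ → ℕ → Polynomial ℂ
  | 0, 0 => 1
  | 0, _ + 1 => 0
  | k + 1, 0 => P * Polynomial.derivative (iterateDopCoeff P k 0)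
  | k + 1, m + 1 =>
    P * (Polynomial.derivative (iterateDopCoeff P k (m + 1)) + iterateDopCoeff P k m)

theorem iterateDopCoeff_eq_zero (P : Polynomial ℂ) {k m : ℕ} (h : k < m) :
    iterateDopCoeff P k m = 0 := by
  induction k generalizing m with
  | zero =>
    obtain ⟨m, rfl⟩ := Nat.exists_eq_succ_of_ne_zero h.ne'
    rfl
  | succ k ih =>
    obtain ⟨m, rfl⟩ := Nat.exists_eq_succ_of_ne_zero (Nat.ne_zero_of_lt h)
    simp [iterateDopCoeff, ih (m := m) (by omega), ih (m := m + 1) (by omega)]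

theorem iterateDopCoeff_self (P : Polynomial ℂ) (k : ℕ) : iterateDopCoeff P k k = P ^ k := by
  induction k with
  | zero => simp [iterateDopCoeff]
  | succ k ih => simp [iterateDopCoeff, ih, iterateDopCoeff_eq_zero P k.lt_succ_self, pow_succ']

theorem iterate_DopP_eventuallyEq (P : Polynomial ℂ) {g : ℂ → ℂ} {t₀ : ℂ}
    (hg : AnalyticAt ℂ g t₀) (k : ℕ) :
    (DopP P)^[k] g =ᶠ[𝓝 t₀] fun t =>
      ∑ m ∈ Finset.range (k + 1), (iterateDopCoeff P k m).eval t * iteratedDeriv m g t := by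
  induction k with
  | zero => simp [iterateDopCoeff]
  | succ k ih =>
    rw [Function.iterate_succ_apply']
    refine (DopP_congr_s9 P ih).trans ?_
    filter_upwards [hg.eventually_analyticAt] with t ht
    have hderiv : ∀ m, HasDerivAt
        (fun s => (iterateDopCoeff P k m).eval s * iteratedDeriv m g s)
        ((iterateDopCoeff P k m).derivative.eval t * iteratedDeriv m g t
          + (iterateDopCoeff P k m).eval t * iteratedDeriv (m + 1) g t) t := fun m => by
      rw [iteratedDeriv_succ]
      exact ((iterateDopCoeff P k m).hasDerivAt t).fun_mul
        (ht.iteratedDeriv_complex m).differentiableAt.hasDerivAt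
    rw [DopP, (HasDerivAt.fun_sum fun m _ => hderiv m).deriv, Finset.sum_add_distrib,
      Finset.sum_range_succ' _ (k + 1)]
    simp only [iterateDopCoeff, Polynomial.eval_mul, Polynomial.eval_add, mul_add, add_mul,
      Finset.sum_add_distrib, Finset.mul_sum]
    rw [Finset.sum_range_succ' _ k, Finset.sum_range_succ
      (fun m => P.eval t * (iterateDopCoeff P k (m + 1)).derivative.eval t
        * iteratedDeriv (m + 1) g t) k, iterateDopCoeff_eq_zero P k.lt_succ_self]
    simp only [mul_assoc, Polynomial.derivative_zero, Polynomial.eval_zero]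
    ring

theorem sum_rows_eventuallyEq_iterate_DopP {n : ℕ} {t₀ : ℂ} {P : Polynomial ℂ}
    {A : Matrix (Fin n) (Fin n) (Polynomial ℂ)} {v : Fin n → ℂ → ℂ}
    (hv : ∀ i, AnalyticAt ℂ (v i) t₀)
    (hvd : ∀ᶠ t in 𝓝 t₀, ∀ i, P.eval t * deriv (v i) t = ∑ m, (A i m).eval t * v m t)
    {q : ℕ → Fin n → Polynomial ℂ}
    (hqs : ∀ k j, q (k + 1) j = P * Polynomial.derivative (q k j) + ∑ m, q k m * A m j) (k : ℕ) :
    (DopP P)^[k] (fun t => ∑ i, (q 0 i).eval t * v i t) =ᶠ[𝓝 t₀]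
      fun t => ∑ i, (q k i).eval t * v i t := by
  induction k with
  | zero => rfl
  | succ k ih =>
    rw [Function.iterate_succ_apply']
    refine (DopP_congr_s9 P ih).trans ?_
    filter_upwards [hvd, eventually_all.2 fun i => (hv i).eventually_analyticAt] with t htd ht
    have hderiv : ∀ i, HasDerivAt (fun s => (q k i).eval s * v i s)
        ((q k i).derivative.eval t * v i t + (q k i).eval t * deriv (v i) t) t := fun i =>
      ((q k i).hasDerivAt t).fun_mul (ht i).differentiableAt.hasDerivAt
    rw [DopP, (HasDerivAt.fun_sum fun i _ => hderiv i).deriv]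
    simp only [hqs, Polynomial.eval_add, Polynomial.eval_mul, Polynomial.eval_finsetSum, add_mul,
      Finset.sum_add_distrib, mul_add, Finset.mul_sum, Finset.sum_mul]
    congr 1
    · exact Finset.sum_congr rfl fun i _ => by ring
    · rw [Finset.sum_comm]
      refine Finset.sum_congr rfl fun i _ => ?_
      rw [mul_left_comm, htd, Finset.mul_sum]
      exact Finset.sum_congr rfl fun m _ => by ring

/-- If `(P · d/dt)^k y_j = ∑ i, q k i * v i j`, then up to a power of `P` the Wronskian
of the `y_j` is the determinant of the `q k i` times the determinant of the `v i j`. -/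
theorem det_rows_mul_det_eventuallyEq {n : ℕ} {t₀ : ℂ} {P : Polynomial ℂ}
    {q : ℕ → Fin n → Polynomial ℂ} {Pmat : ℂ → Matrix (Fin n) (Fin n) ℂ} {y : Fin n → ℂ → ℂ}
    (hy : ∀ j, AnalyticAt ℂ (y j) t₀)
    (hq : ∀ k j, (DopP P)^[k] (y j) =ᶠ[𝓝 t₀] fun t => ∑ i, (q k i).eval t * Pmat t i j) :
    (fun t => (Matrix.of fun k i : Fin n => q (k : ℕ) i).det.eval t * (Pmat t).det) =ᶠ[𝓝 t₀]
      fun t => (∏ k : Fin n, P ^ (k : ℕ)).eval t * wronskian y t := by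
  filter_upwards [eventually_all.2 fun k : Fin n => eventually_all.2 fun j =>
    ((hq k j).symm.trans (iterate_DopP_eventuallyEq P (hy j) k))] with t ht
  set L : Matrix (Fin n) (Fin n) (Polynomial ℂ) := Matrix.of fun k m => iterateDopCoeff P k m
  have hL : L.det = ∏ k : Fin n, P ^ (k : ℕ) := by
    rw [Matrix.det_of_isLowerTriangular L fun k m hkm =>
      iterateDopCoeff_eq_zero P (by simpa using hkm)]
    simp [L, iterateDopCoeff_self]
  rw [← hL, wronskian]
  simp only [← Polynomial.coe_evalRingHom, RingHom.map_det]
  rw [← Matrix.det_mul, ← Matrix.det_mul]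
  congr 1
  ext k j
  simp only [Matrix.mul_apply, RingHom.mapMatrix_apply, Matrix.map_apply, Matrix.of_apply,
    Polynomial.coe_evalRingHom, L]
  rw [ht k j, Fin.sum_univ_eq_sum_range
    (fun m => (iterateDopCoeff P k m).eval t * iteratedDeriv m (y j) t) n]
  refine Finset.sum_subset (Finset.range_subset_range.2 k.2) fun m _ hm => ?_
  rw [iterateDopCoeff_eq_zero P (by simpa using hm)]
  simp

/-- at a non-singular point `t₀` of the system (`P(t₀) ≠ 0`, `det Pmat(t₀) ≠ 0`),
the Wronskian `W(y₁, …, y_n)` vanishes identically near `t₀` iff the polynomial `det Σ` is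
zero, and when nonzero, `ord_{t₀} W(y₁, …, y_n) = ord_{t₀} (det Σ)`. -/
theorem ord_wronskian_eq_ord_det_rows
    (n : ℕ) (t₀ : ℂ)
    (P : Polynomial ℂ) (A : Matrix (Fin n) (Fin n) (Polynomial ℂ))
    (Pmat : ℂ → Matrix (Fin n) (Fin n) ℂ)
    (hPa : ∀ i j, AnalyticAt ℂ (fun t => Pmat t i j) t₀)
    (hPd : ∀ᶠ t in nhds t₀, ∀ i j,
      P.eval t * deriv (fun s => Pmat s i j) t = ∑ m, (A i m).eval t * Pmat t m j)
    (hP0 : P.eval t₀ ≠ 0) (hdet0 : (Pmat t₀).det ≠ 0)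
    (q₀ : Fin n → ℂ) (q : ℕ → Fin n → Polynomial ℂ)
    (hq0 : ∀ j, q 0 j = Polynomial.C (q₀ j))
    (hqs : ∀ k j, q (k + 1) j = P * Polynomial.derivative (q k j) + ∑ m, q k m * A m j)
    (y : Fin n → ℂ → ℂ) (hy : ∀ j, y j = fun t => ∑ i, q₀ i * Pmat t i j) :
    ((∀ᶠ t in nhds t₀, wronskian y t = 0) ↔
        (Matrix.of fun k i : Fin n => q (k : ℕ) i).det = 0) ∧
    ((Matrix.of fun k i : Fin n => q (k : ℕ) i).det ≠ 0 →
      ordAt (wronskian y) t₀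
        = ((Matrix.of fun k i : Fin n => q (k : ℕ) i).det).rootMultiplicity t₀) := by
  have hya : ∀ j, AnalyticAt ℂ (y j) t₀ := fun j => by
    rw [hy]
    exact Finset.analyticAt_fun_sum _ fun i _ => analyticAt_const.fun_mul (hPa i j)
  have hrows : ∀ k j, (DopP P)^[k] (y j) =ᶠ[𝓝 t₀] fun t => ∑ i, (q k i).eval t * Pmat t i j :=
    fun k j => by
      have h := sum_rows_eventuallyEq_iterate_DopP (v := fun i t => Pmat t i j)
        (fun i => hPa i j) (hPd.mono fun t ht i => ht i j) hqs k
      simpa [hy, hq0] using h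
  have hdet := det_rows_mul_det_eventuallyEq hya hrows
  set d := (Matrix.of fun k i : Fin n => q (k : ℕ) i).det
  have hWa : AnalyticAt ℂ (wronskian y) t₀ := analyticAt_wronskian hya
  have hQa := (∏ k : Fin n, P ^ (k : ℕ)).analyticAt_eval t₀
  have hMa := AnalyticAt.matrix_det hPa
  have hQ0 : analyticOrderAt (fun t => (∏ k : Fin n, P ^ (k : ℕ)).eval t) t₀ = 0 :=
    hQa.analyticOrderAt_eq_zero.2 (by
      simp [Polynomial.eval_prod, Finset.prod_ne_zero_iff, hP0])
  have hord : analyticOrderAt (wronskian y) t₀ = analyticOrderAt (fun t => d.eval t) t₀ := by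
    have h := analyticOrderAt_congr hdet
    change analyticOrderAt ((fun t => d.eval t) * fun t => (Pmat t).det) t₀
      = analyticOrderAt ((fun t => (∏ k : Fin n, P ^ (k : ℕ)).eval t) * wronskian y) t₀ at h
    rwa [analyticOrderAt_mul (d.analyticAt_eval t₀) hMa, analyticOrderAt_mul hQa hWa, hQ0,
      hMa.analyticOrderAt_eq_zero.2 hdet0, add_zero, zero_add, eq_comm] at h
  refine ⟨?_, fun hd => ordAt_eq_of_analyticOrderAt_eq hWa
    (hord.trans (Polynomial.analyticOrderAt_eval hd t₀))⟩
  rw [← analyticOrderAt_eq_top, hord]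
  refine ⟨fun h => ?_, fun h => analyticOrderAt_eq_top.2 (by simp [h])⟩
  by_contra hd
  simp [Polynomial.analyticOrderAt_eval hd t₀] at h
end
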